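/- Contraction of g along vertical Lipschitz graphs (abstract form of Lemma 5): Let 0 ≤ γ₀ < 1 and let φ : D → ℂ^{k₁} (D ⊆ ℂ^{k₂}) satisfy Lip(φ) ≤ γ₀. If z₁ = (φ(Y₁), Y₁) and z₂ = (φ(Y₂), Y₂) both lie in B_k(0,R₀) (together with the segment joining them), then ‖g(z₁) − g(z₂)‖ ≤ (γ₀‖A‖ + 2δ(1+γ₀) + ‖B‖) · ‖Y₁ − Y₂‖ ≤ [(γ₀‖A‖ + 2δ(1+γ₀) + ‖B‖)/(1−γ₀)] · ‖z₁ − z₂‖. -/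

import Mathlib

open Metric Set

noncomputable section

/-- ℂ^k with the Euclidean norm. -/
abbrev Eu (k : ℕ) : Type := EuclideanSpace ℂ (Fin k)

/-- ℂ^{k₁} × ℂ^{k₂} with the Euclidean (L²) product norm. -/
abbrev Prod2 (k₁ k₂ : ℕ) : Type := WithLp 2 (Eu k₁ × Eu k₂)

/-- The point (X,Y) of ℂ^{k₁} × ℂ^{k₂}. -/
def mk2 {k₁ k₂ : ℕ} (X : Eu k₁) (Y : Eu k₂) : Prod2 k₁ k₂ :=
  (WithLp.equiv 2 (Eu k₁ × Eu k₂)).symm (X, Y)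

/-- Horizontal coordinate projection π₀. -/
def fst2 {k₁ k₂ : ℕ} (Z : Prod2 k₁ k₂) : Eu k₁ := (WithLp.equiv 2 (Eu k₁ × Eu k₂) Z).1

/-- Vertical coordinate projection π₂. -/
def snd2 {k₁ k₂ : ℕ} (Z : Prod2 k₁ k₂) : Eu k₂ := (WithLp.equiv 2 (Eu k₁ × Eu k₂) Z).2

/-- Horizontal graph {(X, φ(X)) : X ∈ D}. -/
def hgraph {k₁ k₂ : ℕ} (φ : Eu k₁ → Eu k₂) (D : Set (Eu k₁)) : Set (Prod2 k₁ k₂) :=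
  (fun X => mk2 X (φ X)) '' D

/-- Vertical graph {(φ(Y), Y) : Y ∈ D}. -/
def vgraph {k₁ k₂ : ℕ} (φ : Eu k₂ → Eu k₁) (D : Set (Eu k₂)) : Set (Prod2 k₁ k₂) :=
  (fun Y => mk2 (φ Y) Y) '' D

lemma mk2_sub_mk2 {k₁ k₂ : ℕ} (X₁ X₂ : Eu k₁) (Y₁ Y₂ : Eu k₂) :
    mk2 X₁ Y₁ - mk2 X₂ Y₂ = mk2 (X₁ - X₂) (Y₁ - Y₂) := rfl

lemma norm_mk2_le {k₁ k₂ : ℕ} (X : Eu k₁) (Y : Eu k₂) : ‖mk2 X Y‖ ≤ ‖X‖ + ‖Y‖ := by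
  have h : ‖mk2 X Y‖ ^ 2 = ‖X‖ ^ 2 + ‖Y‖ ^ 2 := WithLp.prod_norm_sq_eq_of_L2 _
  nlinarith [norm_nonneg X, norm_nonneg Y, norm_nonneg (mk2 X Y)]

lemma norm_snd_le_norm_mk2 {k₁ k₂ : ℕ} (X : Eu k₁) (Y : Eu k₂) : ‖Y‖ ≤ ‖mk2 X Y‖ := by
  have h : ‖mk2 X Y‖ ^ 2 = ‖X‖ ^ 2 + ‖Y‖ ^ 2 := WithLp.prod_norm_sq_eq_of_L2 _
  nlinarith [norm_nonneg Y, norm_nonneg (mk2 X Y), sq_nonneg ‖X‖]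

/-- Mean value inequality along a segment on which the complex derivative is bounded. -/
lemma norm_sub_le_of_norm_fderiv_le_segment {E F : Type*} [NormedAddCommGroup E]
    [NormedSpace ℂ E] [NormedAddCommGroup F] [NormedSpace ℂ F] {f : E → F} {C : ℝ} {x y : E}
    (hf : ∀ z ∈ segment ℝ x y, DifferentiableAt ℂ f z ∧ ‖fderiv ℂ f z‖ ≤ C) :
    ‖f x - f y‖ ≤ C * ‖x - y‖ :=
  (convex_segment x y).norm_image_sub_le_of_norm_fderiv_le (𝕜 := ℂ)
    (fun z hz => (hf z hz).1) (fun z hz => (hf z hz).2)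
    (right_mem_segment ℝ x y) (left_mem_segment ℝ x y)

/-- Contraction of g along vertical Lipschitz graphs (abstract
form of Lemma 5). -/
theorem contraction_along_vertical_graphs
    (k₁ k₂ : ℕ) (hk₁ : 0 < k₁) (hk₂ : 0 < k₂)
    (A : Eu k₁ ≃L[ℂ] Eu k₁) (B : Eu k₂ →L[ℂ] Eu k₂)
    (R : Prod2 k₁ k₂ → Eu k₁) (U : Prod2 k₁ k₂ → Eu k₂)
    (g : Prod2 k₁ k₂ → Prod2 k₁ k₂) (R₀ δ : ℝ)
    (hR₀ : 0 < R₀) (hδ : 0 ≤ δ)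
    (hg : ∀ Z, g Z = mk2 (A (fst2 Z) + R Z) (B (snd2 Z) + U Z))
    (hg0 : g 0 = 0)
    (hRdiff : ∀ Z ∈ ball (0 : Prod2 k₁ k₂) R₀, DifferentiableAt ℂ R Z ∧ ‖fderiv ℂ R Z‖ ≤ δ)
    (hUdiff : ∀ Z ∈ ball (0 : Prod2 k₁ k₂) R₀, DifferentiableAt ℂ U Z ∧ ‖fderiv ℂ U Z‖ ≤ δ)
    (γ₀ : ℝ) (hγ₀ : 0 ≤ γ₀) (hγ₀1 : γ₀ < 1)
    (φ : Eu k₂ → Eu k₁) (D : Set (Eu k₂))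
    (hφlip : ∀ Y₁ ∈ D, ∀ Y₂ ∈ D, ‖φ Y₁ - φ Y₂‖ ≤ γ₀ * ‖Y₁ - Y₂‖)
    (Y₁ Y₂ : Eu k₂) (hY₁ : Y₁ ∈ D) (hY₂ : Y₂ ∈ D)
    (hseg : segment ℝ (mk2 (φ Y₁) Y₁) (mk2 (φ Y₂) Y₂) ⊆ ball (0 : Prod2 k₁ k₂) R₀) :
    ‖g (mk2 (φ Y₁) Y₁) - g (mk2 (φ Y₂) Y₂)‖ ≤
      (γ₀ * ‖(A : Eu k₁ →L[ℂ] Eu k₁)‖ + 2 * δ * (1 + γ₀) + ‖B‖) * ‖Y₁ - Y₂‖ ∧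
    (γ₀ * ‖(A : Eu k₁ →L[ℂ] Eu k₁)‖ + 2 * δ * (1 + γ₀) + ‖B‖) * ‖Y₁ - Y₂‖ ≤
      (γ₀ * ‖(A : Eu k₁ →L[ℂ] Eu k₁)‖ + 2 * δ * (1 + γ₀) + ‖B‖) / (1 - γ₀) *
        ‖mk2 (φ Y₁) Y₁ - mk2 (φ Y₂) Y₂‖ := by
  have hφ := hφlip Y₁ hY₁ Y₂ hY₂
  have hz : ‖mk2 (φ Y₁) Y₁ - mk2 (φ Y₂) Y₂‖ ≤ (1 + γ₀) * ‖Y₁ - Y₂‖ := by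
    rw [mk2_sub_mk2]
    linarith [norm_mk2_le (φ Y₁ - φ Y₂) (Y₁ - Y₂)]
  have hY : ‖Y₁ - Y₂‖ ≤ ‖mk2 (φ Y₁) Y₁ - mk2 (φ Y₂) Y₂‖ := by
    rw [mk2_sub_mk2]
    exact norm_snd_le_norm_mk2 _ _
  have hRz := norm_sub_le_of_norm_fderiv_le_segment fun z h => hRdiff z (hseg h)
  have hUz := norm_sub_le_of_norm_fderiv_le_segment fun z h => hUdiff z (hseg h)
  constructor
  · set z₁ := mk2 (φ Y₁) Y₁
    set z₂ := mk2 (φ Y₂) Y₂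
    have hA : ‖A (φ Y₁ - φ Y₂)‖ ≤ ‖(A : Eu k₁ →L[ℂ] Eu k₁)‖ * (γ₀ * ‖Y₁ - Y₂‖) :=
      (A : Eu k₁ →L[ℂ] Eu k₁).le_opNorm_of_le hφ
    have hB : ‖B (Y₁ - Y₂)‖ ≤ ‖B‖ * ‖Y₁ - Y₂‖ := B.le_opNorm _
    have hδz := mul_le_mul_of_nonneg_left hz hδ
    have hgz : g z₁ - g z₂ =
        mk2 (A (φ Y₁ - φ Y₂) + (R z₁ - R z₂)) (B (Y₁ - Y₂) + (U z₁ - U z₂)) := by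
      rw [hg, hg, mk2_sub_mk2, map_sub, map_sub, ← add_sub_add_comm, ← add_sub_add_comm]
      rfl
    rw [hgz]
    linarith [norm_mk2_le (A (φ Y₁ - φ Y₂) + (R z₁ - R z₂)) (B (Y₁ - Y₂) + (U z₁ - U z₂)),
      norm_add_le (A (φ Y₁ - φ Y₂)) (R z₁ - R z₂), norm_add_le (B (Y₁ - Y₂)) (U z₁ - U z₂)]
  · have hC : 0 ≤ γ₀ * ‖(A : Eu k₁ →L[ℂ] Eu k₁)‖ + 2 * δ * (1 + γ₀) + ‖B‖ := by positivity
    have hdiv := le_div_self hC (sub_pos.2 hγ₀1) (sub_le_self 1 hγ₀)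
    exact mul_le_mul hdiv hY (norm_nonneg _) (hC.trans hdiv)
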